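/- Let T > 0, b, κ ∈ ℝ, let u : [0,T) × ℝ → ℝ be continuous, continuously differentiable in x, with u and ∂_x u bounded on [0,t'] × ℝ for every t' < T, and let φ be its flow with ∂_x φ(t,x) = exp(∫₀^t ∂_x u(s, φ(s,x)) ds) > 0 and with x ↦ φ(t,x) a strictly increasing bijection of ℝ for each t. Let ρ, m : [0,T) × ℝ → ℝ be continuously differentiable, with ρ solving ∂_t ρ + u ∂_x ρ + (b−1)(∂_x u) ρ = 0, ρ(0,·) = ρ₀, and m solving ∂_t m + u ∂_x m + b (∂_x u) m + κ ρ ∂_x ρ = 0, m(0,·) = m₀. Assume m₀ is supported in the compact interval [β_{m₀}, γ_{m₀}] and ρ₀ is supported in the compact interval [β_{ρ₀}, γ_{ρ₀}]. Then for every t ∈ [0,T) the function x ↦ m(t,x) is compactly supported, with support contained in [φ(t, β), φ(t, γ)] where β = min{β_{m₀}, β_{ρ₀}} and γ = max{γ_{m₀}, γ_{ρ₀}}. -/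

import Mathlib

theorem chain_aux (T : ℝ) (f ft fx : ℝ → ℝ → ℝ) (c c' : ℝ → ℝ)
    (hft : ∀ t ∈ Set.Ico (0 : ℝ) T, ∀ x : ℝ,
      HasDerivWithinAt (fun s => f s x) (ft t x) (Set.Ico 0 T) t)
    (hfx : ∀ t ∈ Set.Ico (0 : ℝ) T, ∀ x : ℝ, HasDerivAt (f t) (fx t x) x)
    (hfx_cont : ContinuousOn (fun q : ℝ × ℝ => fx q.1 q.2)
      (Set.Ico 0 T ×ˢ (Set.univ : Set ℝ)))
    (hc : ∀ t ∈ Set.Ico (0 : ℝ) T, HasDerivWithinAt c (c' t) (Set.Ico 0 T) t)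
    (t : ℝ) (ht : t ∈ Set.Ico (0 : ℝ) T) :
    HasDerivWithinAt (fun s => f s (c s)) (ft t (c t) + c' t * fx t (c t)) (Set.Ico 0 T) t := by
  have key : ∀ s : ℝ, ∃ ξ : ℝ, |ξ - c t| ≤ |c s - c t| ∧
      (s ∈ Set.Ico (0 : ℝ) T → f s (c s) - f s (c t) = fx s ξ * (c s - c t)) := by
    intro s
    by_cases hs : s ∈ Set.Ico (0 : ℝ) T
    swap
    · exact ⟨c t, by simp, fun h => absurd h hs⟩
    rcases lt_trichotomy (c s) (c t) with h | h | h
    · obtain ⟨ξ, hξ, h2⟩ := exists_hasDerivAt_eq_slope (f s) (fx s) h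
        (fun x _ => (hfx s hs x).continuousAt.continuousWithinAt) (fun x _ => hfx s hs x)
      refine ⟨ξ, ?_, fun _ => ?_⟩
      · rw [abs_of_neg (by linarith [hξ.2]), abs_of_neg (by linarith)]; linarith [hξ.1]
      · rw [h2]; have : c t - c s ≠ 0 := by linarith
        field_simp; ring
    · exact ⟨c t, by simp, fun _ => by simp [h]⟩
    · obtain ⟨ξ, hξ, h2⟩ := exists_hasDerivAt_eq_slope (f s) (fx s) h
        (fun x _ => (hfx s hs x).continuousAt.continuousWithinAt) (fun x _ => hfx s hs x)
      refine ⟨ξ, ?_, fun _ => ?_⟩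
      · rw [abs_of_pos (by linarith [hξ.1]), abs_of_pos (by linarith)]; linarith [hξ.2]
      · rw [h2]; have : c s - c t ≠ 0 := by linarith
        field_simp
  choose ξ hξ1 hξ2 using key
  have hξt : ξ t = c t := by
    have := hξ1 t
    simp at this
    linarith
  have hcc : ContinuousWithinAt c (Set.Ico 0 T) t := (hc t ht).continuousWithinAt
  have hξc : Filter.Tendsto ξ (nhdsWithin t (Set.Ico 0 T)) (nhds (c t)) := by
    rw [tendsto_iff_dist_tendsto_zero]
    have h0 : Filter.Tendsto (fun s => dist (c s) (c t)) (nhdsWithin t (Set.Ico 0 T)) (nhds 0) :=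
      (tendsto_iff_dist_tendsto_zero).1 hcc
    exact squeeze_zero (fun _ => dist_nonneg) (fun s => by simpa [Real.dist_eq] using hξ1 s) h0
  have hg : Filter.Tendsto (fun s => fx s (ξ s)) (nhdsWithin t (Set.Ico 0 T))
      (nhds (fx t (c t))) := by
    have h1 := hfx_cont (t, c t) ⟨ht, trivial⟩
    refine Filter.Tendsto.comp (f := fun s => (s, ξ s)) h1 ?_
    refine tendsto_nhdsWithin_iff.2 ⟨?_, ?_⟩
    · exact (Filter.Tendsto.mono_left Filter.tendsto_id nhdsWithin_le_nhds).prodMk_nhds hξc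
    · filter_upwards [self_mem_nhdsWithin] with s hs using ⟨hs, trivial⟩
  have h1 : HasDerivWithinAt (fun s => fx s (ξ s) * (c s - c t)) (c' t * fx t (c t))
      (Set.Ico 0 T) t := by
    rw [hasDerivWithinAt_iff_tendsto_slope, mul_comm]
    have h2 := hasDerivWithinAt_iff_tendsto_slope.1 (hc t ht)
    refine ((hg.mono_left (nhdsWithin_mono _ Set.diff_subset)).mul h2).congr (fun s => ?_)
    simp [slope_def_field]
    ring
  have h3 := (hft t ht (c t)).add h1
  refine h3.congr (fun s hs => ?_) ?_
  · have := hξ2 s hs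
    simp only [Pi.add_apply]
    linarith
  · simp

theorem zero_aux (T : ℝ) (F a : ℝ → ℝ)
    (hbdd : ∀ t' ∈ Set.Ico (0 : ℝ) T, ∃ M : ℝ,
      ∀ t ∈ Set.Icc (0 : ℝ) t', |a t| ≤ M)
    (hF : ∀ t ∈ Set.Ico (0 : ℝ) T, HasDerivWithinAt F (a t * F t) (Set.Ico 0 T) t)
    (h0 : F 0 = 0) (t : ℝ) (ht : t ∈ Set.Ico (0 : ℝ) T) : F t = 0 := by
  obtain ⟨M, hM⟩ := hbdd t ht
  have hsub : Set.Icc 0 t ⊆ Set.Ico 0 T := fun s hs => ⟨hs.1, hs.2.trans_lt ht.2⟩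
  have := norm_le_gronwallBound_of_norm_deriv_right_le (f := F) (f' := fun s => a s * F s)
    (δ := 0) (K := M) (ε := 0) (a := 0) (b := t)
    (fun s hs => ((hF s (hsub hs)).continuousWithinAt).mono hsub)
    (fun s hs => by
      refine (hF s (hsub ⟨hs.1, hs.2.le⟩)).mono_of_mem_nhdsWithin ?_
      exact Filter.mem_of_superset (Ico_mem_nhdsGE (hs.2.trans ht.2))
        (Set.Ico_subset_Ico_left hs.1))
    (by simp [h0])
    (fun s hs => by
      simp only [norm_mul, add_zero, Real.norm_eq_abs]
      exact mul_le_mul_of_nonneg_right (hM s ⟨hs.1, hs.2.le⟩) (abs_nonneg _))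
    t ⟨ht.1, le_rfl⟩
  simpa [gronwallBound_ε0] using this

/-- Propagation of compact support for `m`: if `(m,ρ)` is a `C¹` solution of
`∂_t m + u ∂_x m + b (∂_x u) m + κ ρ ∂_x ρ = 0`, `∂_t ρ + u ∂_x ρ + (b-1)(∂_x u) ρ = 0`
along the flow `φ` of `u` (each `φ(t,·)` a strictly increasing bijection), with `m₀` supported
in `[β_m, γ_m]` and `ρ₀` supported in `[β_ρ, γ_ρ]`, then for every `t ∈ [0,T)` the function
`m(t,·)` is compactly supported, with support contained in `[φ(t, min β_m β_ρ), φ(t, max γ_m γ_ρ)]`. -/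
theorem stmt7 (T b κ βm γm βρ γρ : ℝ) (hT : 0 < T) (hβγm : βm ≤ γm) (hβγρ : βρ ≤ γρ)
    (u ux : ℝ → ℝ → ℝ)
    (hu_cont : ContinuousOn (fun q : ℝ × ℝ => u q.1 q.2)
      (Set.Ico 0 T ×ˢ (Set.univ : Set ℝ)))
    (hux_cont : ContinuousOn (fun q : ℝ × ℝ => ux q.1 q.2)
      (Set.Ico 0 T ×ˢ (Set.univ : Set ℝ)))
    (hux : ∀ t ∈ Set.Ico (0 : ℝ) T, ∀ x : ℝ, HasDerivAt (u t) (ux t x) x)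
    (hbdd : ∀ t' ∈ Set.Ico (0 : ℝ) T, ∃ M : ℝ,
      ∀ t ∈ Set.Icc (0 : ℝ) t', ∀ x : ℝ, |u t x| ≤ M ∧ |ux t x| ≤ M)
    -- φ is the C¹ flow of u, each φ(t,·) a strictly increasing bijection
    (φ : ℝ → ℝ → ℝ)
    (hφC1 : ContDiffOn ℝ 1 (fun q : ℝ × ℝ => φ q.1 q.2) (Set.Ico 0 T ×ˢ (Set.univ : Set ℝ)))
    (hφ0 : ∀ x : ℝ, φ 0 x = x)
    (hφt : ∀ t ∈ Set.Ico (0 : ℝ) T, ∀ x : ℝ,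
      HasDerivWithinAt (fun s => φ s x) (u t (φ t x)) (Set.Ico 0 T) t)
    (hφx : ∀ t ∈ Set.Ico (0 : ℝ) T, ∀ x : ℝ,
      HasDerivAt (φ t) (Real.exp (∫ s in (0 : ℝ)..t, ux s (φ s x))) x)
    (hφmono : ∀ t ∈ Set.Ico (0 : ℝ) T, StrictMono (φ t))
    (hφbij : ∀ t ∈ Set.Ico (0 : ℝ) T, Function.Bijective (φ t))
    -- ρ is a C¹ solution of the transport equation with data ρ₀
    (ρ ρt ρx : ℝ → ℝ → ℝ) (ρ₀ : ℝ → ℝ)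
    (hρ0 : ∀ x : ℝ, ρ 0 x = ρ₀ x)
    (hρt : ∀ t ∈ Set.Ico (0 : ℝ) T, ∀ x : ℝ,
      HasDerivWithinAt (fun s => ρ s x) (ρt t x) (Set.Ico 0 T) t)
    (hρx : ∀ t ∈ Set.Ico (0 : ℝ) T, ∀ x : ℝ, HasDerivAt (ρ t) (ρx t x) x)
    (hρt_cont : ContinuousOn (fun q : ℝ × ℝ => ρt q.1 q.2)
      (Set.Ico 0 T ×ˢ (Set.univ : Set ℝ)))
    (hρx_cont : ContinuousOn (fun q : ℝ × ℝ => ρx q.1 q.2)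
      (Set.Ico 0 T ×ˢ (Set.univ : Set ℝ)))
    (hρeq : ∀ t ∈ Set.Ico (0 : ℝ) T, ∀ x : ℝ,
      ρt t x + u t x * ρx t x + (b - 1) * ux t x * ρ t x = 0)
    -- m is a C¹ solution of the m-equation with data m₀
    (m mt mx : ℝ → ℝ → ℝ) (m₀ : ℝ → ℝ)
    (hm0 : ∀ x : ℝ, m 0 x = m₀ x)
    (hmt : ∀ t ∈ Set.Ico (0 : ℝ) T, ∀ x : ℝ,
      HasDerivWithinAt (fun s => m s x) (mt t x) (Set.Ico 0 T) t)
    (hmx : ∀ t ∈ Set.Ico (0 : ℝ) T, ∀ x : ℝ, HasDerivAt (m t) (mx t x) x)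
    (hmt_cont : ContinuousOn (fun q : ℝ × ℝ => mt q.1 q.2)
      (Set.Ico 0 T ×ˢ (Set.univ : Set ℝ)))
    (hmx_cont : ContinuousOn (fun q : ℝ × ℝ => mx q.1 q.2)
      (Set.Ico 0 T ×ˢ (Set.univ : Set ℝ)))
    (hmeq : ∀ t ∈ Set.Ico (0 : ℝ) T, ∀ x : ℝ,
      mt t x + u t x * mx t x + b * ux t x * m t x + κ * ρ t x * ρx t x = 0)
    -- compact supports of the data
    (hsuppm : Function.support m₀ ⊆ Set.Icc βm γm)
    (hsuppρ : Function.support ρ₀ ⊆ Set.Icc βρ γρ) :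
    ∀ t ∈ Set.Ico (0 : ℝ) T,
      HasCompactSupport (m t) ∧
        Function.support (m t) ⊆ Set.Icc (φ t (min βm βρ)) (φ t (max γm γρ)) := by
  have hb : ∀ (k x : ℝ), ∀ t' ∈ Set.Ico (0 : ℝ) T, ∃ M : ℝ,
      ∀ t ∈ Set.Icc (0 : ℝ) t', |k * ux t (φ t x)| ≤ M := by
    intro k x t' ht'
    obtain ⟨M, hM⟩ := hbdd t' ht'
    refine ⟨|k| * M, fun t ht => ?_⟩
    rw [abs_mul]
    exact mul_le_mul_of_nonneg_left (hM t ht _).2 (abs_nonneg _)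
  have hρz : ∀ x, ρ₀ x = 0 → ∀ t ∈ Set.Ico (0 : ℝ) T, ρ t (φ t x) = 0 := by
    intro x hx
    refine zero_aux T (fun t => ρ t (φ t x)) (fun t => (-(b - 1)) * ux t (φ t x)) (hb _ x)
      (fun t ht => ?_) (by simp [hφ0, hρ0, hx])
    have h := chain_aux T ρ ρt ρx (fun t => φ t x) (fun t => u t (φ t x)) hρt hρx hρx_cont
      (fun t ht => hφt t ht x) t ht
    convert h using 1
    linarith [hρeq t ht (φ t x)]
  have hmz : ∀ x, ρ₀ x = 0 → m₀ x = 0 → ∀ t ∈ Set.Ico (0 : ℝ) T, m t (φ t x) = 0 := by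
    intro x hx hx'
    refine zero_aux T (fun t => m t (φ t x)) (fun t => (-b) * ux t (φ t x)) (hb _ x)
      (fun t ht => ?_) (by simp [hφ0, hm0, hx'])
    have h := chain_aux T m mt mx (fun t => φ t x) (fun t => u t (φ t x)) hmt hmx hmx_cont
      (fun t ht => hφt t ht x) t ht
    convert h using 1
    have h1 := hmeq t ht (φ t x)
    rw [hρz x hx t ht] at h1
    linarith
  intro t ht
  have hs : Function.support (m t) ⊆ Set.Icc (φ t (min βm βρ)) (φ t (max γm γρ)) := by
    intro y hy
    obtain ⟨x, rfl⟩ := (hφbij t ht).2 y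
    have hx : x ∈ Set.Icc (min βm βρ) (max γm γρ) := by
      by_contra hx
      refine hy (hmz x ?_ ?_ t ht)
      · by_contra h
        have := hsuppρ h
        exact hx ⟨(min_le_right _ _).trans this.1, this.2.trans (le_max_right _ _)⟩
      · by_contra h
        have := hsuppm h
        exact hx ⟨(min_le_left _ _).trans this.1, this.2.trans (le_max_left _ _)⟩
    exact ⟨(hφmono t ht).monotone hx.1, (hφmono t ht).monotone hx.2⟩
  exact ⟨HasCompactSupport.of_support_subset_isCompact isCompact_Icc hs, hs⟩
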